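/- Let t₀ ∈ ℝ and let a, b : [t₀,∞) → [0,∞) be measurable functions with a locally integrable. Assume ∫_{t₀}^∞ a(u)du = +∞, b is bounded, and b(u) → 0 as u → ∞. Define A(t) = ∫_{t₀}^t a(u)du and B(t) = e^{−A(t)} ∫_{t₀}^t a(u) e^{A(u)} b(u) du. Then B(t) → 0 as t → ∞. -/

import Mathlib

open Filter MeasureTheory Real

/-- Postcomposition with a Lipschitz function preserves absolute continuity. -/
theorem AbsolutelyContinuousOnInterval.lipschitzOnWith_comp {X Y : Type*} [PseudoMetricSpace X]
    [PseudoMetricSpace Y] {f : ℝ → X} {g : X → Y} {K : NNReal} {s : Set X} {x y : ℝ}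
    (hf : AbsolutelyContinuousOnInterval f x y) (hg : LipschitzOnWith K g s)
    (hs : Set.MapsTo f (Set.uIcc x y) s) :
    AbsolutelyContinuousOnInterval (fun u => g (f u)) x y := by
  have h : Tendsto (fun E : ℕ × (ℕ → ℝ × ℝ) =>
      (K : ℝ) * ∑ i ∈ Finset.range E.1, dist (f (E.2 i).1) (f (E.2 i).2))
      (totalLengthFilter ⊓ 𝓟 (disjWithin x y)) (nhds 0) := by
    simpa using Tendsto.const_mul (K : ℝ) hf
  refine squeeze_zero' (Eventually.of_forall fun E => Finset.sum_nonneg fun _ _ => dist_nonneg)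
    ?_ h
  filter_upwards [mem_inf_of_right (mem_principal_self _)] with E hE
  rw [Finset.mul_sum]
  exact Finset.sum_le_sum fun i hi =>
    hg.dist_le_mul _ (hs (hE.1 i hi).1) _ (hs (hE.1 i hi).2)

/-- The exponential of an absolutely continuous function is absolutely continuous. -/
theorem AbsolutelyContinuousOnInterval.exp {f : ℝ → ℝ} {x y : ℝ}
    (hf : AbsolutelyContinuousOnInterval f x y) :
    AbsolutelyContinuousOnInterval (fun u => Real.exp (f u)) x y := by
  obtain ⟨C, hC⟩ := hf.exists_bound
  obtain ⟨K, hK⟩ := (Real.contDiff_exp (n := 1)).contDiffOn.exists_lipschitzOnWith one_ne_zero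
    (convex_Icc (-C) C) isCompact_Icc
  exact hf.lipschitzOnWith_comp hK fun u hu => abs_le.1 (hC u hu)

/-- Fundamental theorem of calculus for the exponential of a primitive. -/
theorem IntervalIntegrable.integral_mul_exp_primitive {a : ℝ → ℝ} {c t : ℝ}
    (ha : IntervalIntegrable a volume c t) :
    ∫ u in c..t, a u * Real.exp (∫ v in c..u, a v) = Real.exp (∫ v in c..t, a v) - 1 := by
  have h := (ha.absolutelyContinuousOnInterval_intervalIntegral
    (c := c) Set.left_mem_uIcc).exp.integral_deriv_eq_sub
  simp only [intervalIntegral.integral_same, Real.exp_zero] at h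
  rw [← h]
  refine intervalIntegral.integral_congr_ae ?_
  filter_upwards [ha.ae_hasDerivAt_integral] with u hu hut
  rw [(hu (Set.uIoc_subset_uIcc hut) c Set.left_mem_uIcc).exp.deriv, mul_comm]

/-- Lemma A.2 of the paper: if `a ≥ 0` has divergent integral `A(t) = ∫_{t₀}^t a → ∞` and
`b ≥ 0` is bounded with `b(u) → 0`, then the exponentially weighted average
`B(t) = e^{-A(t)} ∫_{t₀}^t a(u) e^{A(u)} b(u) du` tends to `0`. -/
theorem exponential_averaging_lemma
    (t₀ : ℝ) (a b : ℝ → ℝ) (hameas : Measurable a) (hbmeas : Measurable b)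
    (ha0 : ∀ u ≥ t₀, 0 ≤ a u) (hb0 : ∀ u ≥ t₀, 0 ≤ b u)
    (haloc : ∀ t ≥ t₀, IntervalIntegrable a MeasureTheory.volume t₀ t)
    (hadiv : Filter.Tendsto (fun t => ∫ u in t₀..t, a u) Filter.atTop Filter.atTop)
    (hbbd : ∃ M, ∀ u ≥ t₀, b u ≤ M)
    (hblim : Filter.Tendsto b Filter.atTop (nhds 0)) :
    Filter.Tendsto
      (fun t => Real.exp (-(∫ u in t₀..t, a u)) *
        ∫ u in t₀..t, a u * Real.exp (∫ v in t₀..u, a v) * b u)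
      Filter.atTop (nhds 0) := by
  obtain ⟨M, hM⟩ := hbbd
  set A : ℝ → ℝ := fun t => ∫ u in t₀..t, a u
  have hw : ∀ t ≥ t₀, IntervalIntegrable (fun u => a u * exp (A u)) volume t₀ t := fun t ht =>
    (haloc t ht).mul_continuousOn
      ((haloc t ht).absolutelyContinuousOnInterval_intervalIntegral
        (c := t₀) Set.left_mem_uIcc).exp.continuousOn
  have hwb : ∀ t ≥ t₀, IntervalIntegrable (fun u => a u * exp (A u) * b u) volume t₀ t := by
    intro t ht
    rw [intervalIntegrable_iff_integrableOn_Ioc_of_le ht]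
    refine ((intervalIntegrable_iff_integrableOn_Ioc_of_le ht).1 (hw t ht)).mul_bdd (c := M)
      hbmeas.aestronglyMeasurable ?_
    filter_upwards [ae_restrict_mem measurableSet_Ioc] with u hu
    rw [Real.norm_of_nonneg (hb0 u hu.1.le)]
    exact hM u hu.1.le
  have hnonneg : ∀ t ≥ t₀, 0 ≤ exp (-A t) * ∫ u in t₀..t, a u * exp (A u) * b u := fun t ht =>
    mul_nonneg (exp_pos _).le <| intervalIntegral.integral_nonneg ht fun u hu =>
      mul_nonneg (mul_nonneg (ha0 u hu.1) (exp_pos _).le) (hb0 u hu.1)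
  have hexp : Tendsto (fun t => exp (-A t)) atTop (nhds 0) :=
    tendsto_exp_neg_atTop_nhds_zero.comp hadiv
  rw [Metric.tendsto_nhds]
  intro ε hε
  obtain ⟨T, hTt₀, hT⟩ : ∃ T ≥ t₀, ∀ u ≥ T, b u ≤ ε / 2 := by
    obtain ⟨T, hT⟩ := eventually_atTop.1 (hblim.eventually_le_const (half_pos hε))
    exact ⟨max T t₀, le_max_right _ _, fun u hu => hT u ((le_max_left _ _).trans hu)⟩
  set C := ∫ u in t₀..T, a u * exp (A u) * b u
  have hsmall : ∀ᶠ t in atTop, exp (-A t) * C < ε / 2 := by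
    have h := hexp.mul_const C
    rw [zero_mul] at h
    exact h.eventually_lt_const (half_pos hε)
  filter_upwards [hsmall, eventually_ge_atTop T] with t ht hTt
  have htt₀ : t ≥ t₀ := hTt₀.trans hTt
  have hsub : Set.uIcc T t ⊆ Set.uIcc t₀ t := by
    rw [Set.uIcc_of_le hTt, Set.uIcc_of_le htt₀]
    exact Set.Icc_subset_Icc_left hTt₀
  have hw' := (hw t htt₀).mono_set hsub
  have hwb' := (hwb t htt₀).mono_set hsub
  have htail : ∫ u in T..t, a u * exp (A u) * b u ≤ exp (A t) * (ε / 2) := calc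
    _ ≤ ∫ u in T..t, a u * exp (A u) * (ε / 2) :=
      intervalIntegral.integral_mono_on hTt hwb' (hw'.mul_const _) fun u hu =>
        mul_le_mul_of_nonneg_left (hT u hu.1)
          (mul_nonneg (ha0 u (hTt₀.trans hu.1)) (exp_pos _).le)
    _ = (exp (A t) - exp (A T)) * (ε / 2) := by
      rw [intervalIntegral.integral_mul_const,
        ← intervalIntegral.integral_interval_sub_left (hw t htt₀) (hw T hTt₀),
        (haloc t htt₀).integral_mul_exp_primitive, (haloc T hTt₀).integral_mul_exp_primitive]
      ring
    _ ≤ exp (A t) * (ε / 2) := by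
      gcongr
      linarith [exp_pos (A T)]
  rw [Real.dist_0_eq_abs, abs_of_nonneg (hnonneg t htt₀),
    ← intervalIntegral.integral_add_adjacent_intervals (hwb T hTt₀) hwb', mul_add]
  have hcancel : exp (-A t) * (exp (A t) * (ε / 2)) = ε / 2 := by
    rw [← mul_assoc, ← exp_add, neg_add_cancel, exp_zero, one_mul]
  linarith [mul_le_mul_of_nonneg_left htail (exp_pos (-A t)).le]
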